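/- Let C be a semi-dualizing (R,S)-bimodule and M a finitely generated left R-module with G_C-dim_R M < ∞. Then there exists a short exact sequence 0 → F_M → X_M → M → 0 where X_M is a C-reflexive R-module and F_M admits a finite resolution by modules in add(C). -/

import Mathlib

open CategoryTheory

/-- The `i`-th Ext group of finitely generated modules, as a module over `ℤ`. -/
noncomputable abbrev ExtGrp (A : Type) [Ring A] (i : ℕ) (M N : Type) [AddCommGroup M] [Module A M]
    [AddCommGroup N] [Module A N] : Type :=
  ((Ext ℤ (ModuleCat.{0} A) i).obj (Opposite.op (ModuleCat.of A M))).obj (ModuleCat.of A N)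

section Bimodule

variable (R S : Type) [Ring R] [Ring S]
variable (C : Type) [AddCommGroup C] [Module R C] [Module Sᵐᵒᵖ C]
  [SMulCommClass R Sᵐᵒᵖ C] [SMulCommClass Sᵐᵒᵖ R C]

/-- right homothety `S → Hom_R(C,C)`. -/
def rightHomothety (s : S) : C →ₗ[R] C where
  toFun c := MulOpposite.op s • c
  map_add' := smul_add _
  map_smul' r c := smul_comm _ r c

/-- left homothety `R → Hom_S(C,C)`. -/
def leftHomothety (r : R) : C →ₗ[Sᵐᵒᵖ] C where
  toFun c := r • c
  map_add' := smul_add _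
  map_smul' s c := smul_comm _ s c

/-- `C` is a semi-dualizing `(R,S)`-bimodule. -/
structure IsSemidualizing : Prop where
  bij_right : Function.Bijective (rightHomothety R S C)
  bij_left : Function.Bijective (leftHomothety R S C)
  ext_right : ∀ i : ℕ, 0 < i → Subsingleton (ExtGrp R i C C)
  ext_left : ∀ i : ℕ, 0 < i → Subsingleton (ExtGrp Sᵐᵒᵖ i C C)

variable (M : Type) [AddCommGroup M] [Module R M]

/-- the biduality (evaluation) map `M → Hom_S(Hom_R(M,C),C)`. -/
def bidualityMap (m : M) : (M →ₗ[R] C) →ₗ[Sᵐᵒᵖ] C where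
  toFun f := f m
  map_add' _ _ := rfl
  map_smul' _ _ := rfl

/-- a finitely generated left `R`-module `M` is `C`-reflexive. -/
structure IsCReflexive : Prop where
  ext_vanish : ∀ i : ℕ, 0 < i → Subsingleton (ExtGrp R i M C)
  ext_dual_vanish : ∀ i : ℕ, 0 < i → Subsingleton (ExtGrp Sᵐᵒᵖ i (M →ₗ[R] C) C)
  bij : Function.Bijective (bidualityMap R S C M)

variable (N : Type) [AddCommGroup N] [Module Sᵐᵒᵖ N]

/-- the biduality map `N → Hom_R(Hom_S(N,C),C)` for a right `S`-module `N`. -/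
def bidualityMapRight (n : N) : (N →ₗ[Sᵐᵒᵖ] C) →ₗ[R] C where
  toFun f := f n
  map_add' _ _ := rfl
  map_smul' _ _ := rfl

/-- a finitely generated right `S`-module `N` is `C`-reflexive. -/
structure IsCReflexiveRight : Prop where
  ext_vanish : ∀ i : ℕ, 0 < i → Subsingleton (ExtGrp Sᵐᵒᵖ i N C)
  ext_dual_vanish : ∀ i : ℕ, 0 < i → Subsingleton (ExtGrp R i (N →ₗ[Sᵐᵒᵖ] C) C)
  bij : Function.Bijective (bidualityMapRight R S C N)

end Bimodule

section Resolutions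

variable (R : Type) [Ring R]

/-- An exact sequence `⋯ → X^{-(j+1)} → X^{-j} → ⋯ → X^0 → M → 0` of finitely
generated left `R`-modules (a resolution of `M`); `X j` sits in cohomological
degree `-j`. -/
structure FGResolution (M : Type) [AddCommGroup M] [Module R M] where
  X : ℕ → Type
  [acg : ∀ j, AddCommGroup (X j)]
  [mod : ∀ j, Module R (X j)]
  fin : ∀ j, Module.Finite R (X j)
  d : ∀ j, X (j + 1) →ₗ[R] X j
  aug : X 0 →ₗ[R] M
  surj : Function.Surjective aug
  exact_aug : Function.Exact (d 0) aug
  exact : ∀ j, Function.Exact (d (j + 1)) (d j)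

attribute [instance] FGResolution.acg FGResolution.mod

/-- The resolution has length at most `n`, i.e. it is of the form
`0 → X^{-n} → ⋯ → X^0 → M → 0`. -/
def FGResolution.LengthLE {M : Type} [AddCommGroup M] [Module R M]
    (res : FGResolution R M) (n : ℕ) : Prop :=
  ∀ j, n < j → Subsingleton (res.X j)

end Resolutions

section AddC

variable (R S : Type) [Ring R] [Ring S]
variable (C : Type) [AddCommGroup C] [Module R C] [Module Sᵐᵒᵖ C]
  [SMulCommClass R Sᵐᵒᵖ C] [SMulCommClass Sᵐᵒᵖ R C]

/-- `G` belongs to `add(C)`: it is a direct summand of a finite direct sum of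
copies of `C`. -/
def MemAddC (G : Type) [AddCommGroup G] [Module R G] : Prop :=
  ∃ (n : ℕ) (ι : G →ₗ[R] (Fin n → C)) (π : (Fin n → C) →ₗ[R] G),
    π ∘ₗ ι = LinearMap.id

end AddC


lemma extGrp_iff (A : Type) [Ring A] (i : ℕ) (M N : Type) [AddCommGroup M] [Module A M]
    [AddCommGroup N] [Module A N] :
    Subsingleton (ExtGrp A (i + 1) M N) ↔
      Subsingleton (Abelian.Ext (ModuleCat.of A M) (ModuleCat.of A N) (i + 1)) := by
  let P := ProjectiveResolution.of (ModuleCat.of A M)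
  have h1 : Subsingleton (ExtGrp A (i + 1) M N) ↔
      ∀ f : P.complex.X (i + 1) ⟶ ModuleCat.of A N, P.complex.d (i + 2) (i + 1) ≫ f = 0 →
        ∃ g : P.complex.X i ⟶ ModuleCat.of A N, P.complex.d (i + 1) i ≫ g = f := by
    rw [← ModuleCat.isZero_iff_subsingleton,
      (P.isoExt (R := ℤ) (i + 1) (ModuleCat.of A N)).isZero_iff,
      ← HomologicalComplex.exactAt_iff_isZero_homology,
      HomologicalComplex.exactAt_iff' _ i (i + 1) (i + 2) (by simp) (by simp),
      ShortComplex.moduleCat_exact_iff]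
    rfl
  rw [h1]
  constructor
  · intro h
    refine subsingleton_of_forall_eq 0 fun x => ?_
    obtain ⟨f, hf, rfl⟩ := P.extMk_surjective x (i + 2) rfl
    exact (P.extMk_eq_zero_iff f (i + 2) rfl hf i rfl).2 (h f hf)
  · intro h f hf
    exact (P.extMk_eq_zero_iff f (i + 2) rfl hf i rfl).1 (Subsingleton.elim _ _)

section LES

variable {A : Type} [Ring A] {X Y Z : Type} [AddCommGroup X] [AddCommGroup Y] [AddCommGroup Z]
  [Module A X] [Module A Y] [Module A Z] (N : Type) [AddCommGroup N] [Module A N]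

/-- short exact sequences of modules -/
structure SES (f : X →ₗ[A] Y) (g : Y →ₗ[A] Z) : Prop where
  inj : Function.Injective f
  surj : Function.Surjective g
  exact : Function.Exact f g

variable {f : X →ₗ[A] Y} {g : Y →ₗ[A] Z}

/-- the associated short complex -/
abbrev SES.sc (h : SES f g) : ShortComplex (ModuleCat.{0} A) :=
  ShortComplex.mk (ModuleCat.ofHom f) (ModuleCat.ofHom g) (by
    ext x; exact (h.exact (f x)).2 ⟨x, rfl⟩)

lemma SES.se (h : SES f g) : h.sc.ShortExact where
  exact := by
    rw [ShortComplex.moduleCat_exact_iff]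
    intro x hx
    exact (h.exact x).1 hx
  mono_f := (ModuleCat.mono_iff_injective _).2 h.inj
  epi_g := (ModuleCat.epi_iff_surjective _).2 h.surj

variable {N}

lemma SES.ext_mid (h : SES f g) {i : ℕ} (hi : 0 < i) (hX : Subsingleton (ExtGrp A i X N))
    (hZ : Subsingleton (ExtGrp A i Z N)) : Subsingleton (ExtGrp A i Y N) := by
  obtain ⟨i, rfl⟩ := Nat.exists_eq_succ_of_ne_zero hi.ne'
  rw [Nat.succ_eq_add_one, extGrp_iff] at *
  refine subsingleton_of_forall_eq 0 fun x => ?_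
  obtain ⟨y, rfl⟩ := Abelian.Ext.contravariant_sequence_exact₂ h.se _ x (Subsingleton.elim _ _)
  rw [Subsingleton.elim y 0, Abelian.Ext.comp_zero]

lemma SES.ext_left (h : SES f g) {i : ℕ} (hi : 0 < i) (hY : Subsingleton (ExtGrp A i Y N))
    (hZ : Subsingleton (ExtGrp A (i + 1) Z N)) : Subsingleton (ExtGrp A i X N) := by
  obtain ⟨i, rfl⟩ := Nat.exists_eq_succ_of_ne_zero hi.ne'
  rw [Nat.succ_eq_add_one, extGrp_iff] at *
  refine subsingleton_of_forall_eq 0 fun x => ?_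
  obtain ⟨y, rfl⟩ := Abelian.Ext.contravariant_sequence_exact₁ h.se _ x
    (show 1 + (i + 1) = i + 1 + 1 by lia) (Subsingleton.elim _ _)
  rw [Subsingleton.elim y 0, Abelian.Ext.comp_zero]

lemma SES.ext_right (h : SES f g) {i : ℕ} (hi : 0 < i) (hX : Subsingleton (ExtGrp A i X N))
    (hY : Subsingleton (ExtGrp A (i + 1) Y N)) : Subsingleton (ExtGrp A (i + 1) Z N) := by
  obtain ⟨i, rfl⟩ := Nat.exists_eq_succ_of_ne_zero hi.ne'
  rw [Nat.succ_eq_add_one, extGrp_iff] at *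
  refine subsingleton_of_forall_eq 0 fun x => ?_
  obtain ⟨y, rfl⟩ := Abelian.Ext.contravariant_sequence_exact₃ h.se _ x
    (Subsingleton.elim _ _) (show 1 + (i + 1) = i + 1 + 1 by lia)
  rw [Subsingleton.elim y 0, Abelian.Ext.comp_zero]

lemma SES.lift (h : SES f g) (hZ : Subsingleton (ExtGrp A 1 Z N)) (φ : X →ₗ[A] N) :
    ∃ ψ : Y →ₗ[A] N, ψ ∘ₗ f = φ := by
  rw [show (1 : ℕ) = 0 + 1 from rfl, extGrp_iff] at hZ
  obtain ⟨y, hy⟩ := Abelian.Ext.contravariant_sequence_exact₁ h.se (ModuleCat.of A N)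
    (Abelian.Ext.mk₀ (ModuleCat.ofHom φ)) (show 1 + 0 = 0 + 1 by lia) (Subsingleton.elim _ _)
  obtain ⟨ψ, rfl⟩ := Abelian.Ext.addEquiv₀.symm.surjective y
  refine ⟨ψ.hom, ?_⟩
  simp only [Abelian.Ext.addEquiv₀_symm_apply, Abelian.Ext.mk₀_comp_mk₀] at hy
  have := (Abelian.Ext.mk₀_bijective _ _).1 hy
  exact congrArg ModuleCat.Hom.hom this

lemma SES.ext_one (h : SES f g) (hY : Subsingleton (ExtGrp A 1 Y N))
    (hl : ∀ φ : X →ₗ[A] N, ∃ ψ : Y →ₗ[A] N, ψ ∘ₗ f = φ) :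
    Subsingleton (ExtGrp A 1 Z N) := by
  rw [show (1 : ℕ) = 0 + 1 from rfl, extGrp_iff] at *
  refine subsingleton_of_forall_eq 0 fun x => ?_
  obtain ⟨y, rfl⟩ := Abelian.Ext.contravariant_sequence_exact₃ h.se _ x
    (Subsingleton.elim _ _) (show 1 + 0 = 0 + 1 by lia)
  obtain ⟨φ, rfl⟩ := Abelian.Ext.addEquiv₀.symm.surjective y
  obtain ⟨ψ, hψ⟩ := hl φ.hom
  have : φ = h.sc.f ≫ ModuleCat.ofHom ψ := by
    ext x; exact (LinearMap.congr_fun hψ x).symm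
  rw [this, Abelian.Ext.addEquiv₀_symm_apply, ← Abelian.Ext.mk₀_comp_mk₀,
    ShortComplex.ShortExact.extClass_comp_assoc]

lemma ext_proj [Module.Projective A X] {i : ℕ} (hi : 0 < i) : Subsingleton (ExtGrp A i X N) := by
  obtain ⟨i, rfl⟩ := Nat.exists_eq_succ_of_ne_zero hi.ne'
  rw [← ModuleCat.isZero_iff_subsingleton]
  have : Projective (ModuleCat.of A X) := ModuleCat.projective_of_categoryTheory_projective _
  exact isZero_Ext_succ_of_projective _ _ _

end LES

section Dual

variable (A B : Type) [Ring A] [Ring B] (C : Type) [AddCommGroup C] [Module A C] [Module B C]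
  [SMulCommClass A B C]
variable {X Y Z : Type} [AddCommGroup X] [AddCommGroup Y] [AddCommGroup Z]
  [Module A X] [Module A Y] [Module A Z]

/-- The dual of a linear map, linear over the other ring. -/
def dualM (f : X →ₗ[A] Y) : (Y →ₗ[A] C) →ₗ[B] (X →ₗ[A] C) where
  toFun φ := φ ∘ₗ f
  map_add' _ _ := rfl
  map_smul' _ _ := rfl

variable {A B C}

lemma SES.dual {f : X →ₗ[A] Y} {g : Y →ₗ[A] Z} (h : SES f g)
    (hl : ∀ φ : X →ₗ[A] C, ∃ ψ : Y →ₗ[A] C, ψ ∘ₗ f = φ) :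
    SES (dualM A B C g) (dualM A B C f) where
  inj φ ψ e := by
    ext z
    obtain ⟨y, rfl⟩ := h.surj z
    exact LinearMap.congr_fun e y
  surj := hl
  exact φ := by
    constructor
    · intro e
      have hk : LinearMap.ker g ≤ LinearMap.ker φ := by
        intro y hy
        obtain ⟨x, rfl⟩ := (h.exact y).1 hy
        exact LinearMap.congr_fun e x
      refine ⟨(LinearMap.ker g).liftQ φ hk ∘ₗ (g.quotKerEquivOfSurjective h.surj).symm, ?_⟩
      ext y
      change (LinearMap.ker g).liftQ φ hk ((g.quotKerEquivOfSurjective h.surj).symm (g y)) = φ y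
      have : (g.quotKerEquivOfSurjective h.surj).symm (g y) = (LinearMap.ker g).mkQ y := by
        rw [LinearEquiv.symm_apply_eq]; rfl
      rw [this]; rfl
    · rintro ⟨ψ, rfl⟩
      ext x
      change ψ (g (f x)) = 0
      rw [(h.exact (f x)).2 ⟨x, rfl⟩, map_zero]

end Dual

section Five

variable {A : Type} [Ring A] {X Y Z X' Y' Z' : Type} [AddCommGroup X] [AddCommGroup Y]
  [AddCommGroup Z] [AddCommGroup X'] [AddCommGroup Y'] [AddCommGroup Z']
  [Module A X] [Module A Y] [Module A Z] [Module A X'] [Module A Y'] [Module A Z']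
  {f : X →ₗ[A] Y} {g : Y →ₗ[A] Z} {f' : X' →ₗ[A] Y'} {g' : Y' →ₗ[A] Z'}

lemma five_mid (h : SES f g) (h' : SES f' g') (a : X →ₗ[A] X') (b : Y →ₗ[A] Y') (c : Z →ₗ[A] Z')
    (hf : ∀ x, b (f x) = f' (a x)) (hg : ∀ y, c (g y) = g' (b y))
    (ha : Function.Bijective a) (hc : Function.Bijective c) : Function.Bijective b := by
  constructor
  · rw [injective_iff_map_eq_zero]
    intro y hy
    have h1 : g y = 0 := hc.1 (by rw [hg, hy, map_zero, map_zero])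
    obtain ⟨x, rfl⟩ := (h.exact y).1 h1
    have h2 : x = 0 := ha.1 (h'.inj (by rw [← hf, hy, map_zero, map_zero]))
    rw [h2, map_zero]
  · intro w
    obtain ⟨z, hz⟩ := hc.2 (g' w)
    obtain ⟨y, rfl⟩ := h.surj z
    obtain ⟨v, hv⟩ := (h'.exact (w - b y)).1 (by rw [map_sub, ← hg, hz, sub_self])
    obtain ⟨x, rfl⟩ := ha.2 v
    exact ⟨y + f x, by rw [map_add, hf, hv]; abel⟩

lemma five_right (h : SES f g) (h' : SES f' g') (a : X →ₗ[A] X') (b : Y →ₗ[A] Y')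
    (c : Z →ₗ[A] Z') (hf : ∀ x, b (f x) = f' (a x)) (hg : ∀ y, c (g y) = g' (b y))
    (ha : Function.Bijective a) (hb : Function.Bijective b) : Function.Bijective c := by
  constructor
  · rw [injective_iff_map_eq_zero]
    intro z hz
    obtain ⟨y, rfl⟩ := h.surj z
    obtain ⟨v, hv⟩ := (h'.exact (b y)).1 (by rw [← hg, hz])
    obtain ⟨x, rfl⟩ := ha.2 v
    have : y = f x := hb.1 (by rw [hf, hv])
    rw [this]
    exact (h.exact (f x)).2 ⟨x, rfl⟩
  · intro w
    obtain ⟨y', rfl⟩ := h'.surj w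
    obtain ⟨y, rfl⟩ := hb.2 y'
    exact ⟨g y, hg y⟩

end Five

section Refl

variable {R S : Type} [Ring R] [Ring S]
variable {C : Type} [AddCommGroup C] [Module R C] [Module Sᵐᵒᵖ C]
  [SMulCommClass R Sᵐᵒᵖ C] [SMulCommClass Sᵐᵒᵖ R C]
variable {X Y Z : Type} [AddCommGroup X] [AddCommGroup Y] [AddCommGroup Z]
  [Module R X] [Module R Y] [Module R Z] {f : X →ₗ[R] Y} {g : Y →ₗ[R] Z}

variable (R S C X) in
/-- biduality as a linear map -/
def bidL : X →ₗ[R] ((X →ₗ[R] C) →ₗ[Sᵐᵒᵖ] C) where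
  toFun := bidualityMap R S C X
  map_add' x y := by ext φ; exact map_add φ x y
  map_smul' r x := by ext φ; exact map_smul φ r x

lemma SES.bidual (h : SES f g)
    (hl : ∀ φ : X →ₗ[R] C, ∃ ψ : Y →ₗ[R] C, ψ ∘ₗ f = φ)
    (hX : Subsingleton (ExtGrp Sᵐᵒᵖ 1 (X →ₗ[R] C) C)) :
    SES (dualM Sᵐᵒᵖ R C (dualM R Sᵐᵒᵖ C f)) (dualM Sᵐᵒᵖ R C (dualM R Sᵐᵒᵖ C g)) :=
  (h.dual (B := Sᵐᵒᵖ) hl).dual ((h.dual (B := Sᵐᵒᵖ) hl).lift hX)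

lemma refl_mid (h : SES f g) (hX : IsCReflexive R S C X) (hZ : IsCReflexive R S C Z) :
    IsCReflexive R S C Y := by
  have hl := h.lift (hZ.ext_vanish 1 one_pos)
  refine ⟨fun i hi => h.ext_mid hi (hX.ext_vanish i hi) (hZ.ext_vanish i hi), fun i hi =>
    (h.dual (B := Sᵐᵒᵖ) hl).ext_mid hi (hZ.ext_dual_vanish i hi) (hX.ext_dual_vanish i hi), ?_⟩
  exact five_mid h (h.bidual hl (hX.ext_dual_vanish 1 one_pos)) (bidL R S C X) (bidL R S C Y)
    (bidL R S C Z) (fun _ => rfl) (fun _ => rfl) hX.bij hZ.bij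

lemma refl_right (h : SES f g) (hX : IsCReflexive R S C X) (hY : IsCReflexive R S C Y)
    (hl : ∀ φ : X →ₗ[R] C, ∃ ψ : Y →ₗ[R] C, ψ ∘ₗ f = φ) :
    IsCReflexive R S C Z := by
  refine ⟨fun i hi => ?_, fun i hi => (h.dual (B := Sᵐᵒᵖ) hl).ext_left hi
    (hY.ext_dual_vanish i hi) (hX.ext_dual_vanish (i + 1) (Nat.succ_pos i)), ?_⟩
  · obtain ⟨i, rfl⟩ := Nat.exists_eq_succ_of_ne_zero hi.ne'
    rcases Nat.eq_zero_or_pos i with rfl | hi'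
    · exact h.ext_one (hY.ext_vanish 1 one_pos) hl
    · exact h.ext_right hi' (hX.ext_vanish i hi') (hY.ext_vanish _ hi)
  exact five_right h (h.bidual hl (hX.ext_dual_vanish 1 one_pos)) (bidL R S C X) (bidL R S C Y)
    (bidL R S C Z) (fun _ => rfl) (fun _ => rfl) hX.bij hY.bij

lemma refl_zero [Subsingleton X] : IsCReflexive R S C X := by
  have : Subsingleton (X →ₗ[R] C) := ⟨fun a b => by ext x; rw [Subsingleton.elim x 0]; simp⟩
  refine ⟨fun i hi => ext_proj hi, fun i hi => ext_proj hi, fun _ _ _ => Subsingleton.elim _ _,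
    fun φ => ⟨0, ?_⟩⟩
  ext ψ
  rw [Subsingleton.elim ψ 0]
  simp

lemma refl_C (hC : IsSemidualizing R S C) : IsCReflexive R S C C := by
  let e : Sᵐᵒᵖ →ₗ[Sᵐᵒᵖ] (C →ₗ[R] C) := LinearMap.toSpanSingleton Sᵐᵒᵖ _ LinearMap.id
  have he : ∀ f : C →ₗ[R] C, ∃ s : Sᵐᵒᵖ, f = s • LinearMap.id := by
    intro f
    obtain ⟨s, rfl⟩ := hC.bij_right.2 f
    exact ⟨MulOpposite.op s, rfl⟩
  have hb : Function.Bijective e := by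
    constructor
    · intro a b hab
      apply MulOpposite.unop_injective
      apply hC.bij_right.1
      ext c
      exact LinearMap.congr_fun hab c
    · intro f
      obtain ⟨s, rfl⟩ := he f
      exact ⟨s, rfl⟩
  have : Module.Projective Sᵐᵒᵖ (C →ₗ[R] C) :=
    Module.Projective.of_equiv (LinearEquiv.ofBijective e hb)
  refine ⟨hC.ext_right, fun i hi => ext_proj hi, ?_, ?_⟩
  · intro x y hxy
    exact LinearMap.congr_fun hxy LinearMap.id
  · intro φ
    refine ⟨φ LinearMap.id, ?_⟩
    ext f
    obtain ⟨s, rfl⟩ := he f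
    rw [map_smul, map_smul]
    rfl

lemma refl_pow (hC : IsSemidualizing R S C) (m : ℕ) : IsCReflexive R S C (Fin m → C) := by
  induction m with
  | zero => exact refl_zero
  | succ m ih =>
    refine refl_mid (f := LinearMap.single R (fun _ : Fin (m + 1) => C) 0)
      (g := LinearMap.funLeft R C Fin.succ) ⟨?_, ?_, ?_⟩ (refl_C hC) ih
    · intro a b hab
      simpa using congrFun hab 0
    · intro v
      exact ⟨Fin.cons 0 v, by ext i; simp [LinearMap.funLeft]⟩
    · intro v
      constructor
      · intro hv
        refine ⟨v 0, ?_⟩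
        ext i
        refine Fin.cases ?_ (fun i => ?_) i
        · simp
        · have := congrFun hv i
          simpa using this.symm
      · rintro ⟨c, rfl⟩
        ext i
        simp [LinearMap.funLeft]

lemma dual_finite [IsNoetherianRing Sᵐᵒᵖ] [Module.Finite Sᵐᵒᵖ C] [Module.Finite R X] :
    Module.Finite Sᵐᵒᵖ (X →ₗ[R] C) := by
  obtain ⟨k, s, hs⟩ := Module.Finite.exists_fin (R := R) (M := X)
  let e : (X →ₗ[R] C) →ₗ[Sᵐᵒᵖ] (Fin k → C) :=
    { toFun := fun φ i => φ (s i)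
      map_add' := fun _ _ => rfl
      map_smul' := fun _ _ => rfl }
  refine Module.Finite.of_injective e ?_
  intro φ ψ h
  refine LinearMap.ext_on_range hs fun i => ?_
  exact congrFun h i

lemma exists_embed [IsNoetherianRing Sᵐᵒᵖ] [Module.Finite Sᵐᵒᵖ C] [Module.Finite R X]
    (hC : IsSemidualizing R S C) (hX : IsCReflexive R S C X) :
    ∃ (m : ℕ) (j : X →ₗ[R] (Fin m → C)), Function.Injective j ∧
      IsCReflexive R S C ((Fin m → C) ⧸ LinearMap.range j) := by
  have := dual_finite (R := R) (S := S) (C := C) (X := X)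
  obtain ⟨m, s, hs⟩ := Module.Finite.exists_fin (R := Sᵐᵒᵖ) (M := X →ₗ[R] C)
  let j : X →ₗ[R] (Fin m → C) := LinearMap.pi s
  have hlift : ∀ φ : X →ₗ[R] C, ∃ ψ : (Fin m → C) →ₗ[R] C, ψ ∘ₗ j = φ := by
    intro φ
    have hφ : φ ∈ Submodule.span Sᵐᵒᵖ (Set.range s) := by rw [hs]; trivial
    obtain ⟨c, rfl⟩ := (Submodule.mem_span_range_iff_exists_fun _).1 hφ
    refine ⟨∑ i, c i • LinearMap.proj i, ?_⟩
    ext x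
    simp [j]
  have hj : Function.Injective j := by
    intro x y hxy
    apply hX.bij.1
    ext φ
    obtain ⟨ψ, rfl⟩ := hlift φ
    exact congrArg ψ hxy
  refine ⟨m, j, hj, refl_right (f := j) (g := (LinearMap.range j).mkQ) ⟨hj,
    Submodule.mkQ_surjective _, ?_⟩ hX (refl_pow hC m) hlift⟩
  exact LinearMap.exact_map_mkQ_range j

end Refl

section Approx

variable (R S : Type) [Ring R] [Ring S]
variable (C : Type) [AddCommGroup C] [Module R C] [Module Sᵐᵒᵖ C]
  [SMulCommClass R Sᵐᵒᵖ C] [SMulCommClass Sᵐᵒᵖ R C]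

/-- `F` has a finite resolution by modules in `add(C)`. -/
def HasAddRes (F : Type) [AddCommGroup F] [Module R F] : Prop :=
  ∃ (n : ℕ) (res : FGResolution R F), res.LengthLE R n ∧ ∀ j, MemAddC R C (res.X j)

/-- the kernel of the augmentation has a shifted resolution -/
def FGResolution.shift {R : Type} [Ring R] {M : Type} [AddCommGroup M] [Module R M]
    (res : FGResolution R M) : FGResolution R (LinearMap.ker res.aug) where
  X j := res.X (j + 1)
  fin j := res.fin (j + 1)
  d j := res.d (j + 1)
  aug := (res.d 0).codRestrict _ fun x => (res.exact_aug _).2 ⟨x, rfl⟩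
  surj := by
    rintro ⟨x, hx⟩
    obtain ⟨y, rfl⟩ := (res.exact_aug x).1 hx
    exact ⟨y, rfl⟩
  exact_aug x := by
    rw [← res.exact 0 x]
    exact Subtype.ext_iff
  exact j := res.exact (j + 1)

/-- underlying types of the extended resolution -/
def consX (G : Type) (X : ℕ → Type) : ℕ → Type
  | 0 => G
  | j + 1 => X j

instance consAcg (G : Type) (X : ℕ → Type) [AddCommGroup G] [∀ j, AddCommGroup (X j)] :
    ∀ j, AddCommGroup (consX G X j)
  | 0 => inferInstanceAs (AddCommGroup G)
  | j + 1 => inferInstanceAs (AddCommGroup (X j))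

instance consMod (R : Type) [Ring R] (G : Type) (X : ℕ → Type) [AddCommGroup G]
    [∀ j, AddCommGroup (X j)] [Module R G] [∀ j, Module R (X j)] :
    ∀ j, Module R (consX G X j)
  | 0 => inferInstanceAs (Module R G)
  | j + 1 => inferInstanceAs (Module R (X j))

/-- extend a resolution of `F` along a short exact sequence `0 → F → G → F' → 0`. -/
def FGResolution.cons {R : Type} [Ring R] {F G F' : Type} [AddCommGroup F] [Module R F]
    [AddCommGroup G] [Module R G] [AddCommGroup F'] [Module R F'] (hG : Module.Finite R G)
    {f : F →ₗ[R] G} {g : G →ₗ[R] F'} (h : SES f g)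
    (res : FGResolution R F) : FGResolution R F' where
  X := consX G res.X
  acg := consAcg G res.X
  mod := consMod R G res.X
  fin := fun
    | 0 => hG
    | j + 1 => res.fin j
  d := fun
    | 0 => f ∘ₗ res.aug
    | j + 1 => res.d j
  aug := g
  surj := h.surj
  exact_aug x := by
    refine (h.exact x).trans ⟨?_, ?_⟩
    · rintro ⟨y, rfl⟩
      obtain ⟨z, rfl⟩ := res.surj y
      exact ⟨z, rfl⟩
    · rintro ⟨y, rfl⟩
      exact ⟨res.aug y, rfl⟩
  exact := fun
    | 0 => (h.inj.comp_exact_iff_exact (f := res.d 0) (g := res.aug)).2 res.exact_aug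
    | j + 1 => res.exact j

variable {R S C}

lemma HasAddRes.cons {F F' : Type} [AddCommGroup F] [Module R F]
    [AddCommGroup F'] [Module R F'] [Module.Finite R C] {m : ℕ}
    {f : F →ₗ[R] (Fin m → C)} {g : (Fin m → C) →ₗ[R] F'} (h : SES f g)
    (hF : HasAddRes R C F) : HasAddRes R C F' := by
  obtain ⟨n, res, hn, hr⟩ := hF
  refine ⟨n + 1, res.cons inferInstance h, ?_, ?_⟩
  · intro j hj
    cases j with
    | zero => omega
    | succ j => exact hn j (by omega)
  · intro j
    cases j with
    | zero => exact ⟨m, LinearMap.id, LinearMap.id, rfl⟩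
    | succ j => exact hr j

lemma HasAddRes.zero : HasAddRes R C PUnit.{1} := by
  refine ⟨0, ⟨fun _ => PUnit, fun _ => inferInstance, fun _ => 0, 0, fun x => ⟨0, rfl⟩,
    fun x => ⟨fun _ => ⟨0, rfl⟩, fun _ => rfl⟩,
    fun _ x => ⟨fun _ => ⟨0, rfl⟩, fun _ => rfl⟩⟩, ?_, ?_⟩
  · intro j _
    exact inferInstanceAs (Subsingleton PUnit)
  · intro j
    exact ⟨0, 0, 0, rfl⟩

variable (R S C) in
/-- the conclusion of the theorem -/
def HasApprox (M : Type) [AddCommGroup M] [Module R M] : Prop :=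
  ∃ (F X : Type) (_ : AddCommGroup F) (_ : Module R F) (_ : AddCommGroup X) (_ : Module R X),
    Module.Finite R F ∧ Module.Finite R X ∧ IsCReflexive R S C X ∧ HasAddRes R C F ∧
    ∃ (ι : F →ₗ[R] X) (π : X →ₗ[R] M),
      Function.Injective ι ∧ Function.Surjective π ∧ Function.Exact ι π

lemma approx_step [IsNoetherianRing Sᵐᵒᵖ] [Module.Finite Sᵐᵒᵖ C] [Module.Finite R C]
    (hC : IsSemidualizing R S C)
    {M X₀ : Type} [AddCommGroup M] [Module R M] [AddCommGroup X₀] [Module R X₀]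
    [Module.Finite R X₀] (h₀ : IsCReflexive R S C X₀) (p : X₀ →ₗ[R] M)
    (hp : Function.Surjective p) (hK : HasApprox R S C (LinearMap.ker p)) :
    HasApprox R S C M := by
  obtain ⟨F, X, _, _, _, _, hFf, hXf, hX, hF, ι, π, hι, hπ, hιπ⟩ := hK
  obtain ⟨m, j, hj, hQ⟩ := exists_embed hC hX
  let φ : X →ₗ[R] X₀ := (LinearMap.ker p).subtype ∘ₗ π
  have hpφ : ∀ x, p (φ x) = 0 := fun x => (π x).2
  have hφ0 : ∀ x, φ x = 0 ↔ x ∈ Set.range ι := fun x => by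
    rw [← hιπ x]; exact Submodule.coe_eq_zero
  have hφr : ∀ y, p y = 0 → ∃ x, φ x = y := fun y hy => by
    obtain ⟨x, hx⟩ := hπ ⟨y, hy⟩
    exact ⟨x, congrArg Subtype.val hx⟩
  let W : Submodule R ((Fin m → C) × X₀) := LinearMap.range (j.prod φ)
  have hW : ∀ a b, (a, b) ∈ W ↔ ∃ x, j x = a ∧ φ x = b := fun a b => by
    simp [W, LinearMap.mem_range]
  -- the extension `X₀ → Y → C^m / X`
  have s1 : SES (W.mkQ ∘ₗ LinearMap.inr R (Fin m → C) X₀)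
      (W.liftQ ((LinearMap.range j).mkQ ∘ₗ LinearMap.fst R (Fin m → C) X₀) (by
        rintro ⟨a, b⟩ hab
        obtain ⟨x, rfl, rfl⟩ := (hW _ _).1 hab
        exact (Submodule.Quotient.mk_eq_zero _).2 ⟨x, rfl⟩)) := by
    refine ⟨?_, ?_, ?_⟩
    · rw [injective_iff_map_eq_zero]
      intro b hb
      obtain ⟨x, hx, rfl⟩ := (hW _ _).1 ((Submodule.Quotient.mk_eq_zero W).1 hb)
      rw [hj (hx.trans (map_zero j).symm), map_zero]
    · intro q
      obtain ⟨a, rfl⟩ := Submodule.mkQ_surjective _ q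
      exact ⟨W.mkQ (a, 0), rfl⟩
    · intro q
      obtain ⟨⟨a, b⟩, rfl⟩ := Submodule.mkQ_surjective _ q
      constructor
      · intro h
        obtain ⟨x, hx⟩ := (Submodule.Quotient.mk_eq_zero (LinearMap.range j)).1 h
        refine ⟨b - φ x, ((Submodule.Quotient.eq W).2 ((hW _ _).2 ⟨-x, ?_⟩))⟩
        simp [hx]
      · rintro ⟨b', hb'⟩
        rw [← hb']
        exact (Submodule.Quotient.mk_eq_zero _).2 (zero_mem _)
  have hY : IsCReflexive R S C (((Fin m → C) × X₀) ⧸ W) := refl_mid s1 h₀ hQ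
  have s2 : SES (j ∘ₗ ι) (LinearMap.range (j ∘ₗ ι)).mkQ :=
    ⟨hj.comp hι, Submodule.mkQ_surjective _, LinearMap.exact_map_mkQ_range _⟩
  refine ⟨(Fin m → C) ⧸ LinearMap.range (j ∘ₗ ι), ((Fin m → C) × X₀) ⧸ W, inferInstance,
    inferInstance, inferInstance, inferInstance, inferInstance, inferInstance, hY, hF.cons s2,
    (LinearMap.range (j ∘ₗ ι)).liftQ (W.mkQ ∘ₗ LinearMap.inl R (Fin m → C) X₀) ?_,
    W.liftQ (p ∘ₗ LinearMap.snd R (Fin m → C) X₀) ?_, ?_, ?_, ?_⟩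
  · rintro _ ⟨y, rfl⟩
    exact (Submodule.Quotient.mk_eq_zero W).2 ((hW _ _).2 ⟨ι y, rfl, (hφ0 _).2 ⟨y, rfl⟩⟩)
  · rintro ⟨a, b⟩ hab
    obtain ⟨x, rfl, rfl⟩ := (hW _ _).1 hab
    exact hpφ x
  · rw [injective_iff_map_eq_zero]
    intro q hq
    obtain ⟨a, rfl⟩ := Submodule.mkQ_surjective _ q
    obtain ⟨x, rfl, hx⟩ := (hW _ _).1 ((Submodule.Quotient.mk_eq_zero W).1 hq)
    obtain ⟨y, rfl⟩ := (hφ0 x).1 hx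
    exact (Submodule.Quotient.mk_eq_zero _).2 ⟨y, rfl⟩
  · intro z
    obtain ⟨b, rfl⟩ := hp z
    exact ⟨W.mkQ (0, b), rfl⟩
  · intro q
    obtain ⟨⟨a, b⟩, rfl⟩ := Submodule.mkQ_surjective _ q
    constructor
    · intro h
      obtain ⟨x, hx⟩ := hφr b h
      refine ⟨(LinearMap.range (j ∘ₗ ι)).mkQ (a - j x),
        (Submodule.Quotient.eq W).2 ((hW _ _).2 ⟨-x, ?_⟩)⟩
      simp [hx]
    · rintro ⟨q', hq'⟩
      obtain ⟨a', rfl⟩ := Submodule.mkQ_surjective _ q'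
      rw [← hq']
      exact map_zero p

lemma approx_main [IsNoetherianRing R] [IsNoetherianRing Sᵐᵒᵖ] [Module.Finite Sᵐᵒᵖ C]
    [Module.Finite R C] (hC : IsSemidualizing R S C) (n : ℕ) :
    ∀ (M : Type) [AddCommGroup M] [Module R M] (res : FGResolution R M),
      res.LengthLE R n → (∀ j, IsCReflexive R S C (res.X j)) → HasApprox R S C M := by
  induction n with
  | zero =>
    intro M _ _ res hn hr
    refine ⟨PUnit, res.X 0, inferInstance, inferInstance, inferInstance, inferInstance,
      inferInstance, res.fin 0, hr 0, HasAddRes.zero, 0, res.aug,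
      fun _ _ _ => rfl, res.surj, fun x => (res.exact_aug x).trans ⟨?_, ?_⟩⟩
    · rintro ⟨y, rfl⟩
      have := hn 1 one_pos
      exact ⟨0, by rw [Subsingleton.elim y 0]; simp⟩
    · rintro ⟨y, rfl⟩
      exact ⟨0, by simp⟩
  | succ n ih =>
    intro M _ _ res hn hr
    have := res.fin 0
    exact approx_step hC (hr 0) res.aug res.surj
      (ih _ res.shift (fun j hj => hn (j + 1) (by omega)) (fun j => hr (j + 1)))

end Approx

/-- if `M` has finite `G_C`-dimension, then there is a short exact
sequence `0 → F_M → X_M → M → 0` with `X_M` a `C`-reflexive module and `F_M`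
admitting a finite resolution by modules in `add(C)`. -/
theorem reflexive_approximation
    (R S : Type) [Ring R] [IsNoetherianRing R] [Ring S] [IsNoetherianRing Sᵐᵒᵖ]
    (C : Type) [AddCommGroup C] [Module R C] [Module Sᵐᵒᵖ C]
    [SMulCommClass R Sᵐᵒᵖ C] [SMulCommClass Sᵐᵒᵖ R C]
    [Module.Finite R C] [Module.Finite Sᵐᵒᵖ C]
    (hC : IsSemidualizing R S C)
    (M : Type) [AddCommGroup M] [Module R M] [Module.Finite R M]
    (hfin : ∃ n : ℕ, ∃ res : FGResolution R M,
      res.LengthLE R n ∧ ∀ j, IsCReflexive R S C (res.X j)) :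
    ∃ (F X : Type) (_ : AddCommGroup F) (_ : Module R F) (_ : AddCommGroup X)
      (_ : Module R X),
      Module.Finite R F ∧ Module.Finite R X ∧
      IsCReflexive R S C X ∧
      (∃ (n : ℕ) (res : FGResolution R F),
        res.LengthLE R n ∧ ∀ j, MemAddC R C (res.X j)) ∧
      ∃ (ι : F →ₗ[R] X) (π : X →ₗ[R] M),
        Function.Injective ι ∧ Function.Surjective π ∧ Function.Exact ι π := by
  obtain ⟨n, res, hn, hr⟩ := hfin
  exact approx_main hC n M res hn hr
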